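/- arXiv:2511.06170 — 3 statements merged into one kernel-verified Lean document; each statement's English description precedes it below -/
import Mathlib

section
/- Let τ ∈ (0,1], let f : {0,1}^n → {0,1}, let T be a decision tree over {0,1}^n that is everywhere τ-influential with respect to f, and let c ∈ ℝ_{≥0}^n be any cost vector. Then Σ_{i=1}^{n} c_i·δ_i(T) ≤ (1/τ)·Σ_{i=1}^{n} c_i·Inf_i[f]. -/
open Finset
open scoped Classical

noncomputable section

variable {ι : Type*} [Fintype ι] [DecidableEq ι]

/-- Probability of an event under the uniform distribution on `ι → Bool`. -/
def prU (p : (ι → Bool) → Prop) : ℝ :=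
  ((Finset.univ.filter fun x => p x).card : ℝ) / (Fintype.card (ι → Bool) : ℝ)

/-- Expectation of a real-valued function under the uniform distribution on `ι → Bool`. -/
def expU (g : (ι → Bool) → ℝ) : ℝ :=
  (∑ x : ι → Bool, g x) / (Fintype.card (ι → Bool) : ℝ)

/-- `Inf_i[f]`: the influence of coordinate `i` on `f`. -/
def influence (f : (ι → Bool) → Bool) (i : ι) : ℝ :=
  prU fun x => f x ≠ f (Function.update x i (!x i))

/-- `dist(f, g)`: probability that `f` and `g` disagree on a uniform random input. -/
def distU (f g : (ι → Bool) → Bool) : ℝ := prU fun x => f x ≠ g x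

/-- `bias(f)`: the distance of `f` to the nearest constant function. -/
def biasU (f : (ι → Bool) → Bool) : ℝ :=
  min (distU f fun _ => false) (distU f fun _ => true)

/-- The restriction `f_π` of `f` under the partial assignment `π`, viewed as a function
on the full cube (the fixed coordinates are irrelevant, so probabilities/influences over
the full cube agree with those over the unfixed coordinates). -/
def restrictB (f : (ι → Bool) → Bool) (π : ι → Option Bool) : (ι → Bool) → Bool :=
  fun x => f fun i => (π i).getD (x i)

/-- Decision trees over coordinate set `α`: internal nodes query a coordinate
(with a 0-child and a 1-child), leaves are labeled by bits. -/
inductive DTree (α : Type*) where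
  | leaf : Bool → DTree α
  | node : α → DTree α → DTree α → DTree α

namespace DTree

/-- The output of the decision tree on input `x`. -/
def eval : DTree ι → (ι → Bool) → Bool
  | leaf b, _ => b
  | node j t0 t1, x => if x j then eval t1 x else eval t0 x

/-- The computation path of the tree on input `x` queries coordinate `i`. -/
def Queries : DTree ι → (ι → Bool) → ι → Prop
  | leaf _, _, _ => False
  | node j t0 t1, x, i =>
      j = i ∨ (if x j then Queries t1 x i else Queries t0 x i)

end DTree

/-- `δ_i(T)`: probability that `T` queries coordinate `i` on a uniform random input. -/
def deltaU (T : DTree ι) (i : ι) : ℝ := prU fun x => T.Queries x i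

/-- `T` is everywhere `τ`-influential with respect to `f`, starting from the
restriction `π` (for the whole tree, take `π = fun _ => none`): every internal
node queries a coordinate whose influence on the restriction of `f` given by the
root-to-node path is at least `τ`. -/
def DTree.EverywhereInfluential (f : (ι → Bool) → Bool) (τ : ℝ) :
    (ι → Option Bool) → DTree ι → Prop
  | _, .leaf _ => True
  | π, .node j t0 t1 =>
      τ ≤ influence (restrictB f π) j ∧
      DTree.EverywhereInfluential f τ (Function.update π j (some false)) t0 ∧
      DTree.EverywhereInfluential f τ (Function.update π j (some true)) t1

/-- The input obtained from `x` by overwriting the coordinates fixed by `π`. -/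
def overwrite {α : Type*} (π : α → Option Bool) (x : α → Bool) : α → Bool :=
  fun i => (π i).getD (x i)

theorem overwrite_update {α : Type*} [DecidableEq α] {π : α → Option Bool} {j : α}
    (hj : π j = none) (x : α → Bool) (b : Bool) :
    overwrite π (Function.update x j b) = overwrite (Function.update π j (some b)) x := by
  funext k
  by_cases hk : k = j
  · subst hk
    simp [overwrite, hj]
  · simp [overwrite, hk]

theorem overwrite_update_of_fixed {α : Type*} [DecidableEq α] {π : α → Option Bool} {j : α}
    (hj : π j ≠ none) (x : α → Bool) (b : Bool) :
    overwrite π (Function.update x j b) = overwrite π x := by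
  obtain ⟨a, ha⟩ := Option.ne_none_iff_exists'.mp hj
  funext k
  by_cases hk : k = j
  · subst hk
    simp [overwrite, ha]
  · simp [overwrite, hk]

theorem prU_eq_expU (p : (ι → Bool) → Prop) : prU p = expU fun x => if p x then 1 else 0 := by
  simp [prU, expU]

theorem prU_le_one (p : (ι → Bool) → Prop) : prU p ≤ 1 := by
  unfold prU
  refine div_le_one_of_le₀ ?_ (by positivity)
  exact_mod_cast Finset.card_le_univ _

/-- Conditioning an expectation on the value of coordinate `j`. -/
theorem expU_eq_average (g : (ι → Bool) → ℝ) (j : ι) :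
    expU g = (expU (fun x => g (Function.update x j false)) +
      expU (fun x => g (Function.update x j true))) / 2 := by
  have hflip : Function.Involutive fun x : ι → Bool => Function.update x j (!x j) := by
    intro x
    simp
  have hsum : ∑ x : ι → Bool, g (Function.update x j (!x j)) = ∑ x, g x :=
    hflip.bijective.sum_comp g
  have hpair : ∀ x : ι → Bool, g (Function.update x j false) + g (Function.update x j true) =
      g x + g (Function.update x j (!x j)) := by
    intro x
    have hself : Function.update x j (x j) = x := Function.update_eq_self j x
    cases hx : x j <;> rw [hx] at hself <;> simp [hself, add_comm]
  have hdouble : (∑ x : ι → Bool, g (Function.update x j false)) +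
      ∑ x : ι → Bool, g (Function.update x j true) = 2 * ∑ x, g x := by
    rw [← Finset.sum_add_distrib, Finset.sum_congr rfl fun x _ => hpair x,
      Finset.sum_add_distrib, hsum, two_mul]
  unfold expU
  rw [← add_div, hdouble]
  ring

/-- Conditioning a probability on the value of coordinate `j`. -/
theorem prU_eq_average (p : (ι → Bool) → Prop) (j : ι) :
    prU p = (prU (fun x => p (Function.update x j false)) +
      prU (fun x => p (Function.update x j true))) / 2 := by
  simp only [prU_eq_expU]
  exact expU_eq_average _ j

theorem influence_restrictB_of_fixed (f : (ι → Bool) → Bool) {π : ι → Option Bool} {j : ι}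
    (hj : π j ≠ none) : influence (restrictB f π) j = 0 := by
  have h : ∀ x, restrictB f π (Function.update x j (!x j)) = restrictB f π x := fun x =>
    congrArg f (overwrite_update_of_fixed hj x _)
  simp [influence, prU, h]

theorem influence_restrictB_eq_average (f : (ι → Bool) → Bool) {π : ι → Option Bool} {i j : ι}
    (hj : π j = none) (hij : j ≠ i) :
    influence (restrictB f π) i =
      (influence (restrictB f (Function.update π j (some false))) i +
        influence (restrictB f (Function.update π j (some true))) i) / 2 := by
  have h : ∀ b x, restrictB f π (Function.update x j b) =
      restrictB f (Function.update π j (some b)) x := fun b x =>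
    congrArg f (overwrite_update hj x b)
  unfold influence
  rw [prU_eq_average _ j]
  simp only [Function.update_of_ne hij.symm, Function.update_comm hij, h]

/-- The probability that an everywhere `τ`-influential tree rooted at `π` queries `i`, on a
random input consistent with `π`, is at most the influence of `i` on `f_π` divided by `τ`. -/
theorem DTree.EverywhereInfluential.mul_prU_queries_le {f : (ι → Bool) → Bool} {τ : ℝ}
    (hτ : 0 < τ) (i : ι) {T : DTree ι} {π : ι → Option Bool}
    (hT : DTree.EverywhereInfluential f τ π T) :
    τ * prU (fun x => T.Queries (overwrite π x) i) ≤ influence (restrictB f π) i := by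
  induction T generalizing π with
  | leaf b =>
    have h0 : 0 ≤ influence (restrictB f π) i := by
      unfold influence prU
      positivity
    have hfalse : prU (fun x => (DTree.leaf b).Queries (overwrite π x) i) = 0 := by
      simp [prU_eq_expU, expU, DTree.Queries]
    rwa [hfalse, mul_zero]
  | node j t0 t1 ih0 ih1 =>
    obtain ⟨hinf, hT0, hT1⟩ := hT
    have hj : π j = none := by
      by_contra hj
      rw [influence_restrictB_of_fixed f hj] at hinf
      exact absurd hinf (not_le.mpr hτ)
    by_cases hij : j = i
    · subst hij
      exact (mul_le_of_le_one_right hτ.le (prU_le_one _)).trans hinf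
    · have hval : ∀ b x, overwrite (Function.update π j (some b)) x j = b := by
        simp [overwrite]
      rw [influence_restrictB_eq_average f hj hij, prU_eq_average _ j]
      simp only [overwrite_update hj, DTree.Queries, hval, hij, false_or, if_true,
        Bool.false_eq_true, if_false]
      linarith [ih0 hT0, ih1 hT1]

theorem DTree.EverywhereInfluential.mul_deltaU_le_influence {f : (ι → Bool) → Bool} {τ : ℝ}
    (hτ : 0 < τ) {T : DTree ι} (hT : DTree.EverywhereInfluential f τ (fun _ => none) T) (i : ι) :
    τ * deltaU T i ≤ influence f i :=
  hT.mul_prU_queries_le hτ i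

/-- If `τ ∈ (0,1]` and `T` is everywhere `τ`-influential with respect to `f`, then for
every nonnegative cost vector `c`, `Σ_i c_i·δ_i(T) ≤ (1/τ)·Σ_i c_i·Inf_i[f]`. -/
theorem cost_delta_le_inv_tau_mul_cost_influence {n : ℕ} {τ : ℝ}
    (hτ : τ ∈ Set.Ioc (0 : ℝ) 1) (f : (Fin n → Bool) → Bool) (T : DTree (Fin n))
    (hT : DTree.EverywhereInfluential f τ (fun _ => none) T)
    (c : Fin n → ℝ) (hc : ∀ i, 0 ≤ c i) :
    ∑ i : Fin n, c i * deltaU T i ≤ (1 / τ) * ∑ i : Fin n, c i * influence f i := by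
  rw [Finset.mul_sum]
  refine Finset.sum_le_sum fun i _ => ?_
  have h : deltaU T i ≤ 1 / τ * influence f i := by
    rw [one_div, ← div_eq_inv_mul, le_div_iff₀' hτ.1]
    exact hT.mul_deltaU_le_influence hτ.1 i
  calc c i * deltaU T i ≤ c i * (1 / τ * influence f i) := mul_le_mul_of_nonneg_left h (hc i)
    _ = 1 / τ * (c i * influence f i) := by ring
end
end

section
/- There is a universal constant α > 0 such that the following holds for every n ≥ 1: if f : {0,1}^n → {0,1} is symmetric and bias(f) ≥ e^{-n/100}, then Pr_{x ~ uniform({0,1}^n)}[τ^(0)(x) ≥ n/2] ≥ α. -/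
open Finset
open scoped Classical

noncomputable section

variable {ι : Type*} [Fintype ι] [DecidableEq ι]

/-- A symmetric Boolean function: `f x` depends only on the Hamming weight of `x`. -/
def IsSymmetricFn {n : ℕ} (f : (Fin n → Bool) → Bool) : Prop :=
  ∀ x y : Fin n → Bool,
    (Finset.univ.filter fun i => x i = true).card =
      (Finset.univ.filter fun i => y i = true).card → f x = f y

/-- The restriction of `f` fixing the first `t` coordinates to those of `x`. -/
def restrictFirst {n : ℕ} (f : (Fin n → Bool) → Bool) (x : Fin n → Bool) (t : ℕ) :
    (Fin n → Bool) → Bool :=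
  fun y => f fun i => if (i : ℕ) < t then x i else y i

/-- `τ^(ε)(x)`: the smallest `t ∈ {0, …, n}` such that fixing the first `t` coordinates
to `x_1, …, x_t` yields a function of bias at most `ε` (at `t = n` the restriction is a
constant, so the set is nonempty whenever `ε ≥ 0`). -/
def tauStop {n : ℕ} (f : (Fin n → Bool) → Bool) (ε : ℝ) (x : Fin n → Bool) : ℕ :=
  sInf {t : ℕ | biasU (restrictFirst f x t) ≤ ε}

theorem prU_nonneg (p : (ι → Bool) → Prop) : 0 ≤ prU p := by
  unfold prU; positivity

theorem prU_mono {p q : (ι → Bool) → Prop} (h : ∀ x, p x → q x) : prU p ≤ prU q := by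
  unfold prU
  gcongr with x
  exact h x

theorem prU_or_le (p q : (ι → Bool) → Prop) : prU (fun x => p x ∨ q x) ≤ prU p + prU q := by
  unfold prU
  rw [← add_div]
  gcongr
  norm_cast
  refine le_trans (Finset.card_le_card fun x => ?_) (Finset.card_union_le _ _)
  simp

theorem prU_add_prU_not (p : (ι → Bool) → Prop) : prU p + prU (fun x => ¬ p x) = 1 := by
  have h := Finset.card_filter_add_card_filter_not (s := (univ : Finset (ι → Bool))) p
  unfold prU
  rw [← add_div, div_eq_one_iff_eq (by positivity)]
  rw [Finset.card_univ] at h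
  norm_cast
  convert h

theorem prU_eq_zero_iff (p : (ι → Bool) → Prop) : prU p = 0 ↔ ∀ x, ¬ p x := by
  unfold prU
  rw [div_eq_zero_iff]
  simp [Finset.filter_eq_empty_iff]

theorem one_div_two_pow_le_prU {p : (ι → Bool) → Prop} (h : ∃ x, p x) :
    1 / 2 ^ Fintype.card ι ≤ prU p := by
  obtain ⟨x, hx⟩ := h
  have hpos : 0 < (univ.filter fun x => p x).card := Finset.card_pos.2 ⟨x, by simpa using hx⟩
  unfold prU
  rw [Fintype.card_fun, Fintype.card_bool]
  push_cast
  gcongr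
  exact_mod_cast hpos

/-- The sum of the `±1`-valued coordinates of `x` over `A`. -/
def signSum (A : Finset ι) (x : ι → Bool) : ℝ := ∑ i ∈ A, if x i then 1 else -1

theorem signSum_eq {κ : Type*} (A : Finset κ) (x : κ → Bool) :
    signSum A x = 2 * ((A.filter fun i => x i = true).card : ℝ) - A.card := by
  have h := Finset.card_filter_add_card_filter_not (s := A) (fun i => x i = true)
  have h' : ((A.filter fun i => x i = true).card : ℝ) +
      ((A.filter fun i => ¬ x i = true).card : ℝ) = A.card := by exact_mod_cast h
  unfold signSum
  rw [Finset.sum_ite, Finset.sum_const, Finset.sum_const]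
  simp only [nsmul_eq_mul]
  linarith

theorem sum_exp_signSum_le (A : Finset ι) (l : ℝ) :
    ∑ x : ι → Bool, Real.exp (l * signSum A x) ≤
      2 ^ Fintype.card ι * Real.exp (l ^ 2 / 2 * Fintype.card ι) := by
  have hprod : ∀ x : ι → Bool, Real.exp (l * signSum A x) =
      ∏ i, (if i ∈ A then Real.exp (l * if x i then 1 else -1) else 1) := by
    intro x
    rw [signSum, Finset.mul_sum, Real.exp_sum, Finset.prod_ite_mem, Finset.univ_inter]
  simp_rw [hprod]
  rw [← Fintype.prod_sum (fun (i : ι) (b : Bool) =>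
    if i ∈ A then Real.exp (l * if b then 1 else -1) else 1)]
  have hfactor : ∀ i : ι, ∑ b : Bool, (if i ∈ A then Real.exp (l * if b then 1 else -1) else 1)
      ≤ 2 * Real.exp (l ^ 2 / 2) := by
    intro i
    by_cases hi : i ∈ A
    · have := Real.cosh_le_exp_half_sq l
      rw [Real.cosh_eq] at this
      simp [hi]
      linarith
    · have : 1 ≤ Real.exp (l ^ 2 / 2) := Real.one_le_exp (by positivity)
      simp only [hi, if_false, Finset.sum_const, Finset.card_univ, Fintype.card_bool, nsmul_eq_mul]
      push_cast
      linarith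
  calc _ ≤ ∏ _i : ι, (2 * Real.exp (l ^ 2 / 2)) := by
        apply Finset.prod_le_prod
        · intro i _
          apply Finset.sum_nonneg
          intro b _
          split_ifs <;> positivity
        · intro i _
          exact hfactor i
    _ = _ := by
        rw [Finset.prod_const, Finset.card_univ, mul_pow, ← Real.exp_nat_mul, mul_comm (l ^ 2 / 2)]

/-- Chernoff bound for the sum of the signs over a set of coordinates. -/
theorem prU_le_mul_signSum (A : Finset ι) (l a : ℝ) :
    prU (fun x => a ≤ l * signSum A x) ≤ Real.exp (l ^ 2 / 2 * Fintype.card ι - a) := by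
  unfold prU
  rw [Fintype.card_fun, Fintype.card_bool, div_le_iff₀ (by positivity), Real.exp_sub,
    div_mul_eq_mul_div, le_div_iff₀ (Real.exp_pos _)]
  calc _ = ∑ x ∈ univ.filter (fun x => a ≤ l * signSum A x), Real.exp a := by
        rw [Finset.sum_const, nsmul_eq_mul]
    _ ≤ ∑ x ∈ univ.filter (fun x => a ≤ l * signSum A x), Real.exp (l * signSum A x) := by
        apply Finset.sum_le_sum
        intro x hx
        exact Real.exp_le_exp.2 (by simpa using hx)
    _ ≤ ∑ x, Real.exp (l * signSum A x) :=
        Finset.sum_le_sum_of_subset_of_nonneg (Finset.filter_subset _ _)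
          fun _ _ _ => (Real.exp_pos _).le
    _ ≤ _ := sum_exp_signSum_le A l
    _ = _ := by push_cast; ring

theorem prU_le_abs_signSum (A : Finset ι) :
    prU (fun x => (Fintype.card ι : ℝ) / 4 ≤ |signSum A x|) ≤
      2 * Real.exp (-(Fintype.card ι : ℝ) / 32) := by
  have h₁ := prU_le_mul_signSum A (1 / 4) ((Fintype.card ι : ℝ) / 16)
  have h₂ := prU_le_mul_signSum A (-1 / 4) ((Fintype.card ι : ℝ) / 16)
  rw [show (1 / 4 : ℝ) ^ 2 / 2 * Fintype.card ι - (Fintype.card ι : ℝ) / 16 =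
    -(Fintype.card ι : ℝ) / 32 by ring] at h₁
  rw [show (-1 / 4 : ℝ) ^ 2 / 2 * Fintype.card ι - (Fintype.card ι : ℝ) / 16 =
    -(Fintype.card ι : ℝ) / 32 by ring] at h₂
  refine (prU_mono (q := fun x => (Fintype.card ι : ℝ) / 16 ≤ 1 / 4 * signSum A x ∨
    (Fintype.card ι : ℝ) / 16 ≤ -1 / 4 * signSum A x) ?_).trans
    ((prU_or_le _ _).trans (by linarith))
  intro x hx
  rcases le_abs.1 hx with h | h
  · left; linarith
  · right; linarith

theorem biasU_le_prU {f : (ι → Bool) → Bool} {p : (ι → Bool) → Prop}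
    (h : ∀ x y, ¬ p x → ¬ p y → f x = f y) : biasU f ≤ prU p := by
  by_cases hT : ∃ x, ¬ p x ∧ f x = true
  · obtain ⟨x, hx, hfx⟩ := hT
    refine (min_le_right _ _).trans (prU_mono fun y hy => ?_)
    by_contra hpy
    exact hy (by rw [h y x hpy hx, hfx])
  · push Not at hT
    refine (min_le_left _ _).trans (prU_mono fun y hy => ?_)
    by_contra hpy
    exact hT y hpy (by simpa using hy)

theorem biasU_nonpos_iff (f : (ι → Bool) → Bool) : biasU f ≤ 0 ↔ ∀ x y, f x = f y := by
  constructor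
  · intro h x y
    rcases min_le_iff.1 h with h | h
    · have := (prU_eq_zero_iff _).1 (le_antisymm h (prU_nonneg _))
      simp only [ne_eq, not_not] at this
      rw [this x, this y]
    · have := (prU_eq_zero_iff _).1 (le_antisymm h (prU_nonneg _))
      simp only [ne_eq, not_not] at this
      rw [this x, this y]
  · intro h
    have hF : prU (fun _ : ι → Bool => False) = 0 := (prU_eq_zero_iff _).2 fun _ => not_false
    exact hF ▸ biasU_le_prU fun x y _ _ => h x y

/-- If the restriction to a prefix of `x` takes two values, then `τ^(0)(x)` is larger than the
length of that prefix. -/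
theorem lt_tauStop_of_ne {n : ℕ} {f : (Fin n → Bool) → Bool} {x y z : Fin n → Bool} {t : ℕ}
    (h : restrictFirst f x t y ≠ restrictFirst f x t z) : t < tauStop f 0 x := by
  by_contra! hle
  have hne : {s : ℕ | biasU (restrictFirst f x s) ≤ 0}.Nonempty :=
    ⟨n, (biasU_nonpos_iff _).2 fun y z => by simp [restrictFirst]⟩
  have hmem := (biasU_nonpos_iff _).1 (Nat.sInf_mem hne)
  have hcomp : ∀ y, restrictFirst f x t y =
      restrictFirst f x (tauStop f 0 x) (fun i => if (i : ℕ) < t then x i else y i) := by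
    intro y
    unfold restrictFirst
    congr 1
    funext i
    by_cases hi : (i : ℕ) < tauStop f 0 x
    · simp [hi, hi.trans_le hle]
    · simp [hi]
  rw [hcomp y, hcomp z] at h
  exact h (hmem _ _)

theorem card_filter_val_lt {n t : ℕ} (ht : t ≤ n) :
    (univ.filter fun i : Fin n => (i : ℕ) < t).card = t := by
  rw [Fin.card_filter_val_lt, min_eq_right ht]

/-- The Hamming weights reachable by filling in the coordinates after a prefix. -/
theorem exists_weight_eq {n t k : ℕ} (ht : t ≤ n) (x : Fin n → Bool)
    (h₁ : ((univ.filter fun i : Fin n => (i : ℕ) < t).filter fun i => x i = true).card ≤ k)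
    (h₂ : k ≤ ((univ.filter fun i : Fin n => (i : ℕ) < t).filter fun i => x i = true).card
      + (n - t)) :
    ∃ y : Fin n → Bool,
      (univ.filter fun i : Fin n => (if (i : ℕ) < t then x i else y i) = true).card = k := by
  set P := (univ.filter fun i : Fin n => (i : ℕ) < t).filter fun i => x i = true with hP
  have hcard : (univ.filter fun i : Fin n => ¬ (i : ℕ) < t).card = n - t := by
    have := Finset.card_filter_add_card_filter_not (s := (univ : Finset (Fin n)))
      (fun i : Fin n => (i : ℕ) < t)
    rw [card_filter_val_lt ht, Finset.card_univ, Fintype.card_fin] at this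
    omega
  obtain ⟨B, hB, hBc⟩ := Finset.exists_subset_card_eq
    (s := univ.filter fun i : Fin n => ¬ (i : ℕ) < t) (n := k - P.card) (by omega)
  have hBt : ∀ i ∈ B, ¬ (i : ℕ) < t := fun i hi => by simpa using hB hi
  refine ⟨fun i => decide (i ∈ B), ?_⟩
  have hunion : (univ.filter fun i : Fin n => (if (i : ℕ) < t then x i else decide (i ∈ B)) = true)
      = P ∪ B := by
    ext i
    by_cases hi : (i : ℕ) < t
    · have : i ∉ B := fun h => hBt i h hi
      simp [hP, hi, this]
    · simp [hP, hi]
  rw [hunion, Finset.card_union_of_disjoint, hBc]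
  · omega
  · rw [Finset.disjoint_left]
    intro i hi hiB
    exact hBt i hiB (by simp [hP] at hi; exact hi.1)

/-- If a prefix of `x` can be completed to the weights of two points on which a symmetric `f`
differs, then `τ^(0)(x)` exceeds the length of the prefix. -/
theorem IsSymmetricFn.lt_tauStop {n t : ℕ} {f : (Fin n → Bool) → Bool} (hf : IsSymmetricFn f)
    (ht : t ≤ n) {x u v : Fin n → Bool} (huv : f u ≠ f v)
    (h : ∀ z, z = u ∨ z = v →
      ((univ.filter fun i : Fin n => (i : ℕ) < t).filter fun i => x i = true).card ≤
        (univ.filter fun i => z i = true).card ∧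
      (univ.filter fun i => z i = true).card ≤
        ((univ.filter fun i : Fin n => (i : ℕ) < t).filter fun i => x i = true).card + (n - t)) :
    t < tauStop f 0 x := by
  obtain ⟨y, hy⟩ := exists_weight_eq ht x (h u (.inl rfl)).1 (h u (.inl rfl)).2
  obtain ⟨z, hz⟩ := exists_weight_eq ht x (h v (.inr rfl)).1 (h v (.inr rfl)).2
  refine lt_tauStop_of_ne (y := y) (z := z) ?_
  unfold restrictFirst
  rwa [hf _ u hy, hf _ v hz]

/-- A nonconstant symmetric function changes value between two consecutive weights. -/
theorem IsSymmetricFn.exists_ne_succ {n : ℕ} {f : (Fin n → Bool) → Bool} (hf : IsSymmetricFn f)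
    (hne : ∃ u v, f u ≠ f v) :
    ∃ k < n, f (fun i => decide ((i : ℕ) < k)) ≠ f (fun i => decide ((i : ℕ) < k + 1)) := by
  by_contra! h
  have hconst : ∀ k ≤ n, f (fun i => decide ((i : ℕ) < k)) = f (fun i => decide ((i : ℕ) < 0)) := by
    intro k
    induction k with
    | zero => intro _; rfl
    | succ k ih =>
      intro hk
      rw [← h k (by omega), ih (by omega)]
  obtain ⟨u, v, huv⟩ := hne
  have heq : ∀ u, f u = f (fun i => decide ((i : ℕ) < 0)) := by
    intro u
    have hle : (univ.filter fun i => u i = true).card ≤ n := by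
      simpa using Finset.card_le_univ (univ.filter fun i => u i = true)
    rw [← hconst _ hle]
    apply hf
    simp only [decide_eq_true_eq]
    rw [card_filter_val_lt hle]
  exact huv (by rw [heq u, heq v])

theorem IsSymmetricFn.exists_lt_tauStop {n t : ℕ} {f : (Fin n → Bool) → Bool}
    (hf : IsSymmetricFn f) (ht : t < n) (hne : ∃ u v, f u ≠ f v) :
    ∃ x, t < tauStop f 0 x := by
  obtain ⟨k, hk, hfk⟩ := hf.exists_ne_succ hne
  refine ⟨fun i => decide ((i : ℕ) < min k t), hf.lt_tauStop ht.le hfk ?_⟩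
  have hw : ((univ.filter fun i : Fin n => (i : ℕ) < t).filter
      fun i : Fin n => decide ((i : ℕ) < min k t) = true).card = min k t := by
    refine Eq.trans ?_ (card_filter_val_lt (n := n) (t := min k t) (by omega))
    rw [Finset.filter_filter]
    congr 1
    ext i
    simp
  rw [hw]
  rintro z (rfl | rfl) <;> simp only [decide_eq_true_eq] <;>
    rw [card_filter_val_lt (by omega)] <;> omega

theorem IsSymmetricFn.half_le_prU_lt_tauStop {n t : ℕ} {f : (Fin n → Bool) → Bool}
    (hf : IsSymmetricFn f) (hn : 64 ≤ n) (ht : 2 * t ≤ n)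
    (hbias : Real.exp (-(n : ℝ) / 100) ≤ biasU f) :
    1 / 2 ≤ prU (fun x => t < tauStop f 0 x) := by
  have hn' : (64 : ℝ) ≤ n := by exact_mod_cast hn
  have ht' : 2 * (t : ℝ) ≤ n := by exact_mod_cast ht
  have hexp : (4 : ℝ) ≤ Real.exp 2 := by
    have h1 : (2 : ℝ) ≤ Real.exp 1 := by linarith [Real.add_one_le_exp (1 : ℝ)]
    calc (4 : ℝ) = 2 * 2 := by norm_num
      _ ≤ Real.exp 1 * Real.exp 1 := by gcongr
      _ = Real.exp 2 := by rw [← Real.exp_add]; norm_num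
  have htail := fun A : Finset (Fin n) => prU_le_abs_signSum A
  simp only [Fintype.card_fin] at htail
  have hsmall : 2 * Real.exp (-(n : ℝ) / 32) < Real.exp (-(n : ℝ) / 100) := by
    have h1 : Real.exp (-(n : ℝ) / 100) =
        Real.exp (-(n : ℝ) / 32) * Real.exp (17 * n / 800) := by
      rw [← Real.exp_add]; congr 1; ring
    have h2 : 2 < Real.exp (17 * (n : ℝ) / 800) := by
      linarith [Real.add_one_le_exp (17 * (n : ℝ) / 800)]
    rw [h1, mul_comm]
    gcongr
  obtain ⟨u, v, hu, hv, huv⟩ : ∃ u v, |signSum univ u| < (n : ℝ) / 4 ∧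
      |signSum univ v| < (n : ℝ) / 4 ∧ f u ≠ f v := by
    by_contra! h
    have := biasU_le_prU (f := f) (p := fun x => (n : ℝ) / 4 ≤ |signSum univ x|)
      fun x y hx hy => h x y (not_le.1 hx) (not_le.1 hy)
    linarith [htail univ]
  set A := univ.filter fun i : Fin n => (i : ℕ) < t with hA
  have hAc : A.card = t := card_filter_val_lt (by omega)
  have hhalf : 2 * Real.exp (-(n : ℝ) / 32) ≤ 1 / 2 := by
    have h1 : Real.exp (-(n : ℝ) / 32) ≤ Real.exp (-2) := Real.exp_le_exp.2 (by linarith)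
    have h2 : Real.exp (-2) ≤ 1 / 4 := by
      rw [Real.exp_neg, ← one_div]
      exact one_div_le_one_div_of_le (by norm_num) hexp
    linarith
  have hcompl := prU_add_prU_not (fun x : Fin n → Bool => (n : ℝ) / 4 ≤ |signSum A x|)
  refine le_trans (by linarith [htail A]) (prU_mono
    (p := fun x : Fin n → Bool => ¬ (n : ℝ) / 4 ≤ |signSum A x|) fun x hx => ?_)
  refine hf.lt_tauStop (by omega) huv fun z hz => ?_
  have hz' : |signSum univ z| < (n : ℝ) / 4 := by rcases hz with rfl | rfl <;> assumption
  rw [not_le, signSum_eq, hAc, abs_lt] at hx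
  rw [signSum_eq, Finset.card_univ, Fintype.card_fin, abs_lt] at hz'
  obtain ⟨hx₁, hx₂⟩ := hx
  obtain ⟨hz₁, hz₂⟩ := hz'
  constructor
  · rw [← hA, ← Nat.cast_le (α := ℝ)]
    linarith
  · have hsub : ((n - t : ℕ) : ℝ) = n - t := Nat.cast_sub (by omega)
    rw [← hA, ← Nat.cast_le (α := ℝ), Nat.cast_add, hsub]
    linarith

/-- There is a universal constant `α > 0` such that for every `n ≥ 1` and symmetric
`f : {0,1}^n → {0,1}` with `bias(f) ≥ e^{-n/100}`, we have
`Pr_x[τ^(0)(x) ≥ n/2] ≥ α`. -/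
theorem symmetric_tau_zero_large_whp :
    ∃ α : ℝ, 0 < α ∧
      ∀ n : ℕ, 1 ≤ n → ∀ f : (Fin n → Bool) → Bool, IsSymmetricFn f →
        Real.exp (-(n : ℝ) / 100) ≤ biasU f →
        α ≤ prU (fun x : Fin n → Bool => (n : ℝ) / 2 ≤ (tauStop f 0 x : ℝ)) := by
  refine ⟨1 / 2 ^ 64, by positivity, fun n hn f hf hbias => ?_⟩
  refine le_trans ?_ (prU_mono (p := fun x => (n - 1) / 2 < tauStop f 0 x) fun x hx => ?_)
  · rcases le_or_gt 64 n with h64 | h64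
    · refine le_trans (by norm_num) (hf.half_le_prU_lt_tauStop h64 (by omega) hbias)
    · have hne : ∃ u v, f u ≠ f v := by
        by_contra! h
        exact absurd (hbias.trans ((biasU_nonpos_iff f).2 h)) (not_le.2 (Real.exp_pos _))
      refine le_trans ?_ (one_div_two_pow_le_prU (hf.exists_lt_tauStop (by omega) hne))
      rw [Fintype.card_fin]
      gcongr
      norm_num
  · have : n ≤ 2 * tauStop f 0 x := by omega
    have : (n : ℝ) ≤ 2 * tauStop f 0 x := by exact_mod_cast this
    linarith
end
end

section
/- There is a universal constant C > 0 such that the following holds for every n ≥ 1, every ε ∈ (0, 1/2], every symmetric f : {0,1}^n → {0,1}, and every index i* ∈ [n]: (n − i* + 1)·Pr_{x ~ uniform}[τ^(ε)(x) ≥ i*] ≤ C·(1 + log₂(1/ε))·E_{x ~ uniform}[max(τ^(0)(x) − i* + 1, 0)]. -/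
open Finset
open scoped Classical

noncomputable section

variable {ι : Type*} [Fintype ι] [DecidableEq ι]

/-- If `y` has at least `T - t₀` ones and at least `T - t₀` zeros among the coordinates `≥ t₀`, then
the weight of `y` overwritten by `x` on the coordinates `< t₀` is also the weight of some `y'`
overwritten by `x` on the coordinates `< T`. -/
lemma exists_extension_same_weight {n : ℕ} (x y : Fin n → Bool) {t₀ T : ℕ}
    (h : ∀ b : Bool, T - t₀ ≤ #{i : Fin n | t₀ ≤ (i : ℕ) ∧ y i = b}) :
    ∃ y' : Fin n → Bool,
      #{i : Fin n | (if (i : ℕ) < T then x i else y' i) = true} =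
        #{i : Fin n | (if (i : ℕ) < t₀ then x i else y i) = true} := by
  have hinitial : ∀ b : Bool, #{i : Fin n | (i : ℕ) < T ∧ x i = b} ≤
      #{i : Fin n | (if (i : ℕ) < t₀ then x i else y i) = b} := by
    intro b
    have hsub : ({i : Fin n | (i : ℕ) < T ∧ x i = b} : Finset (Fin n)) ⊆
        ({i : Fin n | (i : ℕ) < t₀ ∧ x i = b} : Finset (Fin n)) ∪
          ({i : Fin n | t₀ ≤ (i : ℕ) ∧ (i : ℕ) < T} : Finset (Fin n)) := by
      intro i
      simp only [mem_filter, mem_union, mem_univ, true_and]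
      rintro ⟨h₁, h₂⟩
      by_cases h₃ : (i : ℕ) < t₀
      · exact Or.inl ⟨h₃, h₂⟩
      · exact Or.inr ⟨by omega, h₁⟩
    have hmid : #{i : Fin n | t₀ ≤ (i : ℕ) ∧ (i : ℕ) < T} ≤ T - t₀ := by
      rw [← Nat.card_Ico, ← card_map Fin.valEmbedding]
      refine card_le_card fun j hj => ?_
      simp only [mem_map, mem_filter, mem_univ, true_and] at hj
      obtain ⟨i, hi, rfl⟩ := hj
      simpa using hi
    have hsplit : #{i : Fin n | (if (i : ℕ) < t₀ then x i else y i) = b} =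
        #{i : Fin n | (i : ℕ) < t₀ ∧ x i = b} + #{i : Fin n | t₀ ≤ (i : ℕ) ∧ y i = b} := by
      rw [← card_union_of_disjoint]
      · congr 1
        ext i
        simp only [mem_filter, mem_union, mem_univ, true_and]
        split_ifs with h₃
        · simp [h₃, not_le.2 h₃]
        · simp [h₃, not_lt.1 h₃]
      · rw [disjoint_filter]
        intro i _ h₁ h₂
        omega
    have := (card_le_card hsub).trans (card_union_le _ _)
    have := h b
    omega
  let z : Fin n → Bool := fun i => if (i : ℕ) < t₀ then x i else y i
  have hzn : #{i | z i = true} + #{i | z i = false} = n := by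
    have := card_filter_add_card_filter_not (s := (univ : Finset (Fin n))) (fun i => z i = true)
    simpa using this
  have hxn : #{i : Fin n | (i : ℕ) < T ∧ x i = true} + #{i : Fin n | (i : ℕ) < T ∧ x i = false} +
      #{i : Fin n | ¬ (i : ℕ) < T} = n := by
    have h₁ := card_filter_add_card_filter_not (s := (univ : Finset (Fin n)))
      (fun i => (i : ℕ) < T)
    have h₂ := card_filter_add_card_filter_not (s := ({i : Fin n | (i : ℕ) < T} : Finset (Fin n)))
      (fun i => x i = true)
    simp only [filter_filter, Bool.not_eq_true] at h₂
    rw [h₂, h₁]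
    simp
  have h₁ : _ ≤ #{i | z i = true} := hinitial true
  have h₀ : _ ≤ #{i | z i = false} := hinitial false
  obtain ⟨S, hS, hcard⟩ := exists_subset_card_eq
    (s := ({i : Fin n | ¬ (i : ℕ) < T} : Finset (Fin n)))
    (n := #{i | z i = true} - #{i : Fin n | (i : ℕ) < T ∧ x i = true}) (by omega)
  refine ⟨fun i => decide (i ∈ S), ?_⟩
  have hunion : ({i : Fin n | (if (i : ℕ) < T then x i else decide (i ∈ S)) = true} :
      Finset (Fin n)) = ({i : Fin n | (i : ℕ) < T ∧ x i = true} : Finset (Fin n)) ∪ S := by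
    ext i
    have hi : i ∈ S → ¬ (i : ℕ) < T := fun hi => by simpa using hS hi
    simp only [mem_filter, mem_union, mem_univ, true_and]
    split_ifs with h₃
    · simp [h₃, show i ∉ S from fun h => hi h h₃]
    · simp [h₃]
  rw [hunion, card_union_of_disjoint, hcard]
  · exact Nat.add_sub_of_le h₁
  · rw [disjoint_left]
    intro i hi hiS
    have := hS hiS
    simp at this hi
    omega

/-- Chernoff bound for the number of coordinates `≥ t₀` with value `b`. -/
lemma card_few_le (n t₀ s : ℕ) (b : Bool) :
    (#{y : Fin n → Bool | #{i : Fin n | t₀ ≤ (i : ℕ) ∧ y i = b} < s} : ℝ) ≤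
      2 ^ s * (2 ^ n * (3 / 4) ^ (n - t₀)) := by
  have hgen : ∑ y : Fin n → Bool, (1 / 2 : ℝ) ^ #{i : Fin n | t₀ ≤ (i : ℕ) ∧ y i = b} =
      2 ^ n * (3 / 4) ^ (n - t₀) := by
    have hprod : ∀ y : Fin n → Bool, (1 / 2 : ℝ) ^ #{i : Fin n | t₀ ≤ (i : ℕ) ∧ y i = b} =
        ∏ i : Fin n, if t₀ ≤ (i : ℕ) ∧ y i = b then (1 / 2 : ℝ) else 1 := by
      intro y
      rw [prod_ite]
      simp
    have hsum : ∀ i : Fin n, ∑ c : Bool, (if t₀ ≤ (i : ℕ) ∧ c = b then (1 / 2 : ℝ) else 1) =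
        2 * if t₀ ≤ (i : ℕ) then 3 / 4 else 1 := by
      intro i
      by_cases h : t₀ ≤ (i : ℕ) <;> cases b <;> simp [h] <;> norm_num
    have hcount : #{i : Fin n | t₀ ≤ (i : ℕ)} = n - t₀ := by
      rw [← Nat.card_Ico, ← card_map Fin.valEmbedding]
      congr 1
      ext j
      simp only [mem_map, mem_filter, mem_univ, true_and, Fin.valEmbedding_apply, mem_Ico]
      exact ⟨fun ⟨i, hi, h⟩ => h ▸ ⟨hi, i.2⟩, fun h => ⟨⟨j, h.2⟩, h.1, rfl⟩⟩
    simp_rw [hprod]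
    rw [← Fintype.piFinset_univ, ← prod_univ_sum (fun _ => univ)
      (fun (i : Fin n) (c : Bool) => if t₀ ≤ (i : ℕ) ∧ c = b then (1 / 2 : ℝ) else 1)]
    simp_rw [hsum]
    rw [prod_mul_distrib, prod_ite]
    simp [hcount, div_pow]
  rw [← hgen, mul_sum, card_filter, Nat.cast_sum]
  refine sum_le_sum fun y _ => ?_
  split_ifs with h
  · rw [Nat.cast_one, one_div, inv_pow, ← div_eq_mul_inv, one_le_div (by positivity)]
    exact pow_le_pow_right₀ (by norm_num) h.le
  · simp only [Nat.cast_zero]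
    positivity

lemma biasU_le_distU (g : (ι → Bool) → Bool) (c : Bool) : biasU g ≤ distU g fun _ => c := by
  cases c
  · exact min_le_left _ _
  · exact min_le_right _ _

lemma distU_const_eq (g : (ι → Bool) → Bool) (c : Bool) :
    (distU g fun _ => c) = (#{y | g y ≠ c} : ℝ) / (Fintype.card (ι → Bool) : ℝ) := by
  unfold distU prU
  congr!

lemma distU_const_eq_zero {g : (ι → Bool) → Bool} {c : Bool} (h : ∀ y, g y = c) :
    (distU g fun _ => c) = 0 := by
  simp [distU, prU, h]

lemma exists_const_of_biasU_le_zero {g : (ι → Bool) → Bool} (h : biasU g ≤ 0) :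
    ∃ c, ∀ y, g y = c := by
  have key : ∀ c : Bool, (distU g fun _ => c) ≤ 0 → ∀ y, g y = c := by
    intro c hc y
    have hpos : (0 : ℝ) < Fintype.card (ι → Bool) := by exact_mod_cast Fintype.card_pos
    have hcard : (#{y | g y ≠ c} : ℝ) ≤ 0 := by
      by_contra! hlt
      exact absurd hc (not_le.2 (distU_const_eq g c ▸ div_pos hlt hpos))
    have hcard' : #{y | g y ≠ c} = 0 := by exact_mod_cast le_antisymm hcard (Nat.cast_nonneg _)
    by_contra hne
    exact (filter_eq_empty_iff.1 (card_eq_zero.1 hcard') (mem_univ y)) hne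
  rcases min_le_iff.1 h with h | h
  · exact ⟨_, key _ h⟩
  · exact ⟨_, key _ h⟩

lemma biasU_restrictFirst_self {n : ℕ} (f : (Fin n → Bool) → Bool) (x : Fin n → Bool) :
    biasU (restrictFirst f x n) ≤ 0 :=
  (biasU_le_distU _ (f x)).trans (distU_const_eq_zero fun y => by simp [restrictFirst]).le

/-- If fixing the first `T` coordinates of a symmetric function makes it constant, then fixing
only the first `t₀` leaves a function whose bias is governed by a binomial tail. -/
lemma biasU_restrictFirst_le {n : ℕ} {f : (Fin n → Bool) → Bool} (hf : IsSymmetricFn f)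
    (x : Fin n → Bool) (t₀ : ℕ) {T : ℕ}
    (h : biasU (restrictFirst f x T) ≤ 0) :
    biasU (restrictFirst f x t₀) ≤ 2 * 2 ^ (T - t₀) * (3 / 4) ^ (n - t₀) := by
  obtain ⟨c, hc⟩ := exists_const_of_biasU_le_zero h
  refine (biasU_le_distU _ c).trans ?_
  rw [distU_const_eq]
  have hsub : ({y | restrictFirst f x t₀ y ≠ c} : Finset (Fin n → Bool)) ⊆
      ({y | #{i : Fin n | t₀ ≤ (i : ℕ) ∧ y i = true} < T - t₀} : Finset (Fin n → Bool)) ∪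
        ({y | #{i : Fin n | t₀ ≤ (i : ℕ) ∧ y i = false} < T - t₀} : Finset (Fin n → Bool)) := by
    intro y
    simp only [mem_filter, mem_union, mem_univ, true_and]
    contrapose!
    rintro ⟨h₁, h₀⟩
    obtain ⟨y', hy'⟩ := exists_extension_same_weight x y (Bool.rec h₀ h₁)
    rw [← hc y']
    exact (hf _ _ hy').symm
  have hcard : (#{y | restrictFirst f x t₀ y ≠ c} : ℝ) ≤
      2 ^ (T - t₀) * (2 ^ n * (3 / 4) ^ (n - t₀)) +
        2 ^ (T - t₀) * (2 ^ n * (3 / 4) ^ (n - t₀)) := by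
    refine le_trans ?_ (add_le_add (card_few_le n t₀ (T - t₀) true) (card_few_le n t₀ (T - t₀) false))
    exact_mod_cast (card_le_card hsub).trans (card_union_le _ _)
  have hpow : (Fintype.card (Fin n → Bool) : ℝ) = 2 ^ n := by simp
  rw [hpow, div_le_iff₀ (by positivity)]
  linarith

/-- A lower bound on the exponent `s` in the tail bound `2 * 2 ^ s * (3 / 4) ^ m`. -/
lemma le_of_lt_tail {m s : ℕ} {ε : ℝ} (hε : 0 < ε) (hε' : ε ≤ 1 / 2) (hs : 1 ≤ s)
    (h : ε < 2 * 2 ^ s * (3 / 4) ^ m) :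
    (m : ℝ) ≤ 8 * (1 + Real.logb 2 (1 / ε)) * s := by
  have hL : 0 ≤ Real.logb 2 (1 / ε) :=
    Real.logb_nonneg (by norm_num) (by rw [le_div_iff₀ hε]; linarith)
  have hs' : (1 : ℝ) ≤ s := by exact_mod_cast hs
  rcases le_or_gt (m : ℝ) (4 * s) with hm | hm
  · nlinarith
  have hlog := Real.logb_lt_logb (b := 2) (by norm_num) hε h
  rw [Real.logb_mul (by positivity) (by positivity), Real.logb_mul (by positivity) (by positivity),
    Real.logb_pow, Real.logb_pow, Real.logb_self_eq_one (by norm_num)] at hlog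
  have hbase : Real.logb 2 (3 / 4) ≤ -(3 / 8) := by
    have h8 : Real.logb 2 ((3 / 4) ^ 8) ≤ Real.logb 2 ((2 ^ 3)⁻¹) :=
      Real.logb_le_logb_of_le (by norm_num) (by norm_num) (by norm_num)
    rw [Real.logb_inv, Real.logb_pow, Real.logb_pow, Real.logb_self_eq_one (by norm_num)] at h8
    push_cast at h8
    linarith
  have hm0 : (m : ℝ) * Real.logb 2 (3 / 4) ≤ m * -(3 / 8) :=
    mul_le_mul_of_nonneg_left hbase (Nat.cast_nonneg m)
  have hinv : Real.logb 2 (1 / ε) = -Real.logb 2 ε := by rw [one_div, Real.logb_inv]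
  nlinarith

/-- There is a universal constant `C > 0` such that for every `n ≥ 1`, `ε ∈ (0, 1/2]`,
symmetric `f : {0,1}^n → {0,1}` and index `i* ∈ [n]`:
`(n − i* + 1)·Pr_x[τ^(ε)(x) ≥ i*] ≤ C·(1 + log₂(1/ε))·E_x[max(τ^(0)(x) − i* + 1, 0)]`. -/
theorem symmetric_tau_eps_vs_tau_zero :
    ∃ C : ℝ, 0 < C ∧
      ∀ n : ℕ, 1 ≤ n → ∀ ε : ℝ, 0 < ε → ε ≤ 1 / 2 →
        ∀ f : (Fin n → Bool) → Bool, IsSymmetricFn f →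
          ∀ istar : ℕ, 1 ≤ istar → istar ≤ n →
            ((n : ℝ) - istar + 1) * prU (fun x : Fin n → Bool => istar ≤ tauStop f ε x) ≤
              C * (1 + Real.logb 2 (1 / ε)) *
                expU (fun x : Fin n → Bool => max ((tauStop f 0 x : ℝ) - istar + 1) 0) := by
  refine ⟨8, by norm_num, fun n hn ε hε hε' f hf istar hi hin => ?_⟩
  have hL : 0 ≤ Real.logb 2 (1 / ε) :=
    Real.logb_nonneg (by norm_num) (by rw [le_div_iff₀ hε]; linarith)
  have pointwise : ∀ x : Fin n → Bool, istar ≤ tauStop f ε x →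
      (n : ℝ) - istar + 1 ≤
        8 * (1 + Real.logb 2 (1 / ε)) * ((tauStop f 0 x : ℝ) - istar + 1) := by
    intro x hx
    have hlarge : ∀ t < istar, ε < biasU (restrictFirst f x t) := fun t ht =>
      not_le.1 fun h => absurd (Nat.sInf_le h) (not_le.2 (ht.trans_le hx))
    have hT : biasU (restrictFirst f x (tauStop f 0 x)) ≤ 0 :=
      Nat.sInf_mem (s := {t | biasU (restrictFirst f x t) ≤ 0}) ⟨n, biasU_restrictFirst_self f x⟩
    have hiT : istar ≤ tauStop f 0 x := by
      by_contra! hlt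
      linarith [hlarge _ hlt]
    have hbias := (hlarge (istar - 1) (by omega)).trans_le
      (biasU_restrictFirst_le hf x (istar - 1) hT)
    have := le_of_lt_tail hε hε' (by omega) hbias
    rw [Nat.cast_sub (by omega : istar - 1 ≤ n),
      Nat.cast_sub (by omega : istar - 1 ≤ tauStop f 0 x), Nat.cast_sub hi] at this
    push_cast at this
    convert this using 1 <;> ring
  unfold prU expU
  rw [← mul_div_assoc, ← mul_div_assoc]
  refine div_le_div_of_nonneg_right ?_ (Nat.cast_nonneg _)
  rw [card_filter, Nat.cast_sum, mul_sum, mul_sum]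
  refine sum_le_sum fun x _ => ?_
  split_ifs with hx
  · rw [Nat.cast_one, mul_one]
    exact (pointwise x hx).trans (by gcongr; exact le_max_left _ _)
  · rw [Nat.cast_zero, mul_zero]
    positivity
end
end
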